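/- The Mehta-type Gaussian integral with Vandermonde interaction evaluates as \(\int_{\mathbb{R}^n} \prod_{i=1}^n e^{-u_i^2} \prod_{1\le j<k\le n} |u_j-u_k|^{4/\beta}\, du = \frac{\pi^{n/2}}{2^{n(n-1)/\beta}} \prod_{j=2}^n \frac{\Gamma(1+2j/\beta)}{\Gamma(1+2/\beta)}\). -/

import Mathlib

open Real MeasureTheory Finset

namespace Mehta

/-- absolute value of the Vandermonde product -/
noncomputable def V {n : ℕ} (x : Fin n → ℝ) : ℝ := ∏ i, ∏ j ∈ Ioi i, |x j - x i|

/-- interlacing -/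
def Il {n : ℕ} (x : Fin (n + 1) → ℝ) (y : Fin n → ℝ) : Prop :=
  ∀ i : Fin n, x i.castSucc < y i ∧ y i < x i.succ

/-- mixed product -/
noncomputable def Pr {n m : ℕ} (x : Fin m → ℝ) (y : Fin n → ℝ) : ℝ := ∏ i, ∏ j, |x i - y j|

/-- nodal weights -/
noncomputable def W {n : ℕ} (x : Fin n → ℝ) (i : Fin n) : ℝ := ∏ k ∈ univ.erase i, (x i - x k)

lemma V_eq_det {n : ℕ} (x : Fin n → ℝ) : V x = |(Matrix.vandermonde x).det| := by
  simp [V, Matrix.det_vandermonde, Finset.abs_prod]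

lemma V_nonneg {n : ℕ} (x : Fin n → ℝ) : 0 ≤ V x := by
  rw [V_eq_det]; positivity

lemma V_pos {n : ℕ} {x : Fin n → ℝ} (hx : Function.Injective x) : 0 < V x := by
  rw [V_eq_det]
  exact abs_pos.2 (Matrix.det_vandermonde_ne_zero_iff.2 hx)

lemma V_eq_zero {n : ℕ} {x : Fin n → ℝ} (hx : ¬ Function.Injective x) : V x = 0 := by
  rw [V_eq_det, abs_eq_zero]
  by_contra h
  exact hx (Matrix.det_vandermonde_ne_zero_iff.1 h)

lemma prod_W {n : ℕ} (x : Fin n → ℝ) : ∏ i, |W x i| = V x ^ 2 := by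
  have h := Finset.prod_prod_Ioi_mul_eq_prod_prod_off_diag (fun i j : Fin n => |x j - x i|)
  have h2 : ∏ i, |W x i| = ∏ i : Fin n, ∏ j ∈ {i}ᶜ, |x i - x j| := by
    refine Finset.prod_congr rfl fun i _ => ?_
    rw [W, Finset.abs_prod]
    refine Finset.prod_congr ?_ fun _ _ => rfl
    ext; simp
  rw [h2, ← h, V, ← Finset.prod_pow]
  refine Finset.prod_congr rfl fun i _ => ?_
  rw [← Finset.prod_pow]
  refine Finset.prod_congr rfl fun j _ => ?_
  rw [abs_sub_comm (x i) (x j)]; ring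

lemma W_ne {n : ℕ} {x : Fin n → ℝ} (hx : Function.Injective x) (i) : W x i ≠ 0 := by
  rw [W, Finset.prod_ne_zero_iff]
  intro k hk
  have := Finset.ne_of_mem_erase hk
  exact sub_ne_zero.2 (fun h => this (hx h).symm)

lemma Il.strictMono_left {n : ℕ} {x : Fin (n + 1) → ℝ} {y : Fin n → ℝ} (h : Il x y) :
    StrictMono x := by
  rw [Fin.strictMono_iff_lt_succ]
  intro i
  exact (h i).1.trans (h i).2

lemma Il.lt_of_lt {n : ℕ} {x : Fin (n + 1) → ℝ} {y : Fin n → ℝ} (h : Il x y) {i : Fin (n+1)}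
    {j : Fin n} (hij : i ≤ j.castSucc) : x i < y j :=
  (h.strictMono_left.monotone hij).trans_lt (h j).1

lemma Il.gt_of_gt {n : ℕ} {x : Fin (n + 1) → ℝ} {y : Fin n → ℝ} (h : Il x y) {i : Fin (n+1)}
    {j : Fin n} (hij : j.castSucc < i) : y j < x i :=
  (h j).2.trans_le (h.strictMono_left.monotone (Fin.castSucc_lt_iff_succ_le.1 hij))

lemma Il.strictMono_right {n : ℕ} {x : Fin (n + 1) → ℝ} {y : Fin n → ℝ} (h : Il x y) :
    StrictMono y := by
  intro i j hij
  exact (h i).2.trans_le ((h.strictMono_left.monotone (by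
    rw [← Fin.castSucc_lt_iff_succ_le]; simpa using hij)).trans (h j).1.le)

lemma Il.ne {n : ℕ} {x : Fin (n + 1) → ℝ} {y : Fin n → ℝ} (h : Il x y) (i j) : x i ≠ y j := by
  rcases le_or_gt i j.castSucc with h1 | h1
  · exact (h.lt_of_lt h1).ne
  · exact (h.gt_of_gt h1).ne'

lemma Il.Pr_pos {n : ℕ} {x : Fin (n + 1) → ℝ} {y : Fin n → ℝ} (h : Il x y) : 0 < Pr x y :=
  Finset.prod_pos fun i _ => Finset.prod_pos fun j _ => abs_pos.2 (sub_ne_zero.2 (h.ne i j))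

/-- The bordered Cauchy matrix. -/
noncomputable def M {n : ℕ} (x : Fin (n + 1) → ℝ) (y : Fin n → ℝ) :
    Matrix (Fin (n + 1)) (Fin (n + 1)) ℝ :=
  Matrix.of fun i => Fin.cons 1 (fun j => (x i - y j)⁻¹)

/-- cleared matrix -/
noncomputable def N {n : ℕ} (x : Fin (n + 1) → ℝ) (y : Fin n → ℝ) :
    Matrix (Fin (n + 1)) (Fin (n + 1)) ℝ :=
  Matrix.of fun i => Fin.cons (∏ j, (x i - y j)) (fun j => ∏ k ∈ univ.erase j, (x i - y k))

open Polynomial in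
lemma N_eq {n : ℕ} (y : Fin n → ℝ) : ∃ C : Matrix (Fin (n + 1)) (Fin (n + 1)) ℝ, ∀ x,
    N x y = Matrix.vandermonde x * C := by
  let p : Fin (n + 1) → ℝ[X] := Fin.cons (∏ j, (X - C (y j)))
    (fun j => ∏ k ∈ univ.erase j, (X - C (y k)))
  have hp : ∀ i, (p i).natDegree < n + 1 := by
    intro i
    refine Fin.cases ?_ (fun j => ?_) i
    · simp only [p, Fin.cons_zero]
      rw [Polynomial.natDegree_finsetProd_X_sub_C_eq_card]; simp
    · simp only [p, Fin.cons_succ]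
      rw [Polynomial.natDegree_finsetProd_X_sub_C_eq_card]
      simp
  refine ⟨Matrix.of fun i j => (p j).coeff i, fun x => ?_⟩
  ext i j
  have : N x y i j = (p j).eval (x i) := by
    refine Fin.cases ?_ (fun j => ?_) j
    · simp [N, p, Polynomial.eval_prod]
    · simp [N, p, Polynomial.eval_prod]
  rw [this, Polynomial.eval_eq_sum_range' (hp j), Matrix.mul_apply, Finset.sum_range]
  refine Finset.sum_congr rfl fun k _ => ?_
  simp [Matrix.vandermonde_apply, mul_comm]

lemma V_cons {n : ℕ} (w : ℝ) (y : Fin n → ℝ) :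
    V (Fin.cons w y : Fin (n+1) → ℝ) = (∏ j, |y j - w|) * V y := by
  simp [V, Fin.prod_univ_succ, Fin.prod_Ioi_succ]

lemma det_N {n : ℕ} (x : Fin (n + 1) → ℝ) {y : Fin n → ℝ} (hy : Function.Injective y) :
    |(N x y).det| = V x * V y := by
  obtain ⟨C, hC⟩ := N_eq y
  obtain ⟨w, hw⟩ : ∃ w : ℝ, ∀ j, y j ≠ w := by
    obtain ⟨w, hw⟩ := (Set.finite_range y).exists_notMem
    exact ⟨w, fun j h => hw ⟨j, h⟩⟩
  have h1 : |(N (Fin.cons w y) y).det| = (∏ j, |y j - w|) * V y ^ 2 := by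
    rw [Matrix.det_of_upperTriangular]
    · rw [Fin.prod_univ_succ, abs_mul, Finset.abs_prod, ← prod_W]
      simp [N, Finset.abs_prod, W, abs_sub_comm]
    · intro i j hij
      simp only [id] at hij
      revert hij
      refine Fin.cases (fun h => by simp at h) (fun i => ?_) i
      refine Fin.cases (fun h => ?_) (fun j h => ?_) j
      · simp [N, Finset.prod_eq_zero_iff, sub_eq_zero]
      · simp only [N, Matrix.of_apply, Fin.cons_succ, Finset.prod_eq_zero_iff]
        refine ⟨i, ?_, by simp⟩
        simp at h ⊢
        exact h.ne'
  have hpos : 0 < ∏ j, |y j - w| :=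
    Finset.prod_pos fun j _ => abs_pos.2 (sub_ne_zero.2 (hw j))
  rw [hC, Matrix.det_mul, abs_mul, ← V_eq_det, V_cons] at h1
  rw [hC, Matrix.det_mul, abs_mul, ← V_eq_det]
  have hV := V_pos hy
  congr 1
  have : (∏ j, |y j - w|) * V y * (|C.det| - V y) = 0 := by linarith
  have h3 := (mul_eq_zero.1 this).resolve_left (by positivity)
  linarith

lemma det_M {n : ℕ} {x : Fin (n + 1) → ℝ} {y : Fin n → ℝ} (hy : Function.Injective y)
    (hxy : ∀ i j, x i ≠ y j) : |(M x y).det| * Pr x y = V x * V y := by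
  have : N x y = Matrix.diagonal (fun i => ∏ j, (x i - y j)) * M x y := by
    ext i j
    rw [Matrix.diagonal_mul]
    refine Fin.cases ?_ (fun j => ?_) j
    · simp [N, M]
    · simp only [N, M, Matrix.of_apply, Fin.cons_succ]
      rw [← Finset.mul_prod_erase _ _ (mem_univ j)]
      have := sub_ne_zero.2 (hxy i j)
      field_simp
  rw [← det_N x hy, this, Matrix.det_mul, Matrix.det_diagonal, abs_mul, Pr, Finset.abs_prod]
  simp_rw [Finset.abs_prod]
  ring

end Mehta

open Real MeasureTheory Finset
namespace Mehta

lemma W_adj {m : ℕ} {z : Fin (m + 1) → ℝ} (hz : StrictMono z) (i : Fin m) :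
    W z i.castSucc * W z i.succ < 0 := by
  have hne : i.castSucc ≠ i.succ := Fin.castSucc_lt_succ.ne
  have h1 : W z i.castSucc = (z i.castSucc - z i.succ) *
      ∏ k ∈ (univ.erase i.castSucc).erase i.succ, (z i.castSucc - z k) := by
    rw [W, Finset.mul_prod_erase _ (fun k => z i.castSucc - z k)]
    simp [hne.symm]
  have h2 : W z i.succ = (z i.succ - z i.castSucc) *
      ∏ k ∈ (univ.erase i.castSucc).erase i.succ, (z i.succ - z k) := by
    rw [W, Finset.erase_right_comm, Finset.mul_prod_erase _ (fun k => z i.succ - z k)]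
    simp [hne]
  have h3 : 0 < ∏ k ∈ (univ.erase i.castSucc).erase i.succ,
      ((z i.castSucc - z k) * (z i.succ - z k)) := by
    refine Finset.prod_pos fun k hk => ?_
    simp only [mem_erase, mem_univ, and_true] at hk
    rcases lt_or_gt_of_ne hk.2 with h | h
    · have a1 := hz h
      have a2 := hz (Fin.castSucc_lt_succ (i := i))
      exact mul_pos (by linarith) (by linarith)
    · have h' : i.succ < k := lt_of_le_of_ne (Fin.castSucc_lt_iff_succ_le.1 h) hk.1.symm
      have a1 := hz h'
      have a2 := hz (Fin.castSucc_lt_succ (i := i))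
      exact mul_pos_of_neg_of_neg (by linarith) (by linarith)
  rw [Finset.prod_mul_distrib] at h3
  have h4 := hz (Fin.castSucc_lt_succ (i := i))
  rw [h1, h2]
  have : 0 < (z i.succ - z i.castSucc) ^ 2 := by
    have : 0 < z i.succ - z i.castSucc := by linarith
    positivity
  nlinarith [mul_pos this h3]

lemma exists_roots {m : ℕ} {z : Fin (m + 1) → ℝ} (hz : StrictMono z) {F : ℝ → ℝ}
    (hF : Continuous F) (h : ∀ i, 0 < F (z i) * W z i) :
    ∃ r : Fin m → ℝ, Il z r ∧ ∀ i, F (r i) = 0 := by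
  have key : ∀ i : Fin m, ∃ r, (z i.castSucc < r ∧ r < z i.succ) ∧ F r = 0 := by
    intro i
    have h1 := h i.castSucc
    have h2 := h i.succ
    have h3 := W_adj hz i
    have hlt := hz (Fin.castSucc_lt_succ (i := i))
    rcases lt_or_ge 0 (W z i.castSucc) with h4 | h4
    · have h5 : W z i.succ < 0 := by
        by_contra hh; push Not at hh; nlinarith [mul_nonneg h4.le hh]
      have h6 : 0 < F (z i.castSucc) := (pos_iff_pos_of_mul_pos h1).2 h4
      have h7 : F (z i.succ) < 0 := (neg_iff_neg_of_mul_pos h2).2 h5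
      obtain ⟨r, hr, h0⟩ := intermediate_value_Ioo' hlt.le hF.continuousOn ⟨h7, h6⟩
      exact ⟨r, hr, h0⟩
    · have h4' : W z i.castSucc < 0 := by
        rcases h4.lt_or_eq with h | h
        · exact h
        · rw [h] at h3; simp at h3
      have h5 : 0 < W z i.succ := by
        by_contra hh; push Not at hh; nlinarith [mul_nonneg_of_nonpos_of_nonpos h4 hh]
      have h6 : F (z i.castSucc) < 0 := (neg_iff_neg_of_mul_pos h1).2 h4'
      have h7 : 0 < F (z i.succ) := (pos_iff_pos_of_mul_pos h2).2 h5
      obtain ⟨r, hr, h0⟩ := intermediate_value_Ioo hlt.le hF.continuousOn ⟨h6, h7⟩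
      exact ⟨r, hr, h0⟩
  choose r hr using key
  exact ⟨r, fun i => (hr i).1, fun i => (hr i).2⟩

open Polynomial

/-- node polynomial -/
noncomputable def P {n : ℕ} (x : Fin n → ℝ) : ℝ[X] := ∏ i, (X - C (x i))

/-- punctured node polynomial -/
noncomputable def R {n : ℕ} (x : Fin n → ℝ) (i : Fin n) : ℝ[X] := ∏ k ∈ univ.erase i, (X - C (x k))

lemma P_deg {n : ℕ} (x : Fin n → ℝ) : (P x).natDegree = n := by
  rw [P, Polynomial.natDegree_finsetProd_X_sub_C_eq_card]; simp

lemma P_monic {n : ℕ} (x : Fin n → ℝ) : (P x).Monic := Polynomial.monic_prod_X_sub_C _ _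

lemma R_deg {n : ℕ} (x : Fin n → ℝ) (i) : (R x i).natDegree + 1 = n := by
  rw [R, Polynomial.natDegree_finsetProd_X_sub_C_eq_card]; simp
  have := i.pos
  omega

lemma R_monic {n : ℕ} (x : Fin n → ℝ) (i) : (R x i).Monic := Polynomial.monic_prod_X_sub_C _ _

lemma P_eval {n : ℕ} (x : Fin n → ℝ) (t : ℝ) : (P x).eval t = ∏ i, (t - x i) := by
  simp [P, Polynomial.eval_prod]

lemma R_eval {n : ℕ} (x : Fin n → ℝ) (i) (t : ℝ) :
    (R x i).eval t = ∏ k ∈ univ.erase i, (t - x k) := by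
  simp [R, Polynomial.eval_prod]

lemma P_eval_self {n : ℕ} (x : Fin n → ℝ) (i) : (P x).eval (x i) = 0 := by
  rw [P_eval]; exact Finset.prod_eq_zero (mem_univ i) (by simp)

lemma sum_R_eval {n : ℕ} (x : Fin n → ℝ) (b : Fin n → ℝ) (i) :
    (∑ j, C (b j) * R x j).eval (x i) = b i * W x i := by
  rw [Polynomial.eval_finsetSum, Finset.sum_eq_single i]
  · simp [R_eval, W]
  · intro j _ hj
    rw [Polynomial.eval_mul, R_eval, Finset.prod_eq_zero (i := i), mul_zero]
    · simp [hj.symm]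
    · simp
  · simp

lemma P_coeff {n : ℕ} (x : Fin n → ℝ) : (X ^ 2 * P x).coeff (n + 2) = 1 ∧
    (X ^ 2 * P x).coeff (n + 1) = - ∑ i, x i ∧
    2 * (X ^ 2 * P x).coeff n = (∑ i, x i) ^ 2 - ∑ i, x i ^ 2 := by
  induction n with
  | zero => simp [P, Polynomial.coeff_X_pow]
  | succ n ih =>
    have hP : X ^ 2 * P x = (X ^ 2 * P (fun i : Fin n => x i.succ)) * (X - C (x 0)) := by
      simp [P, Fin.prod_univ_succ]; ring
    obtain ⟨h1, h2, h3⟩ := ih (fun i : Fin n => x i.succ)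
    have h0 : (X ^ 2 * P (fun i : Fin n => x i.succ)).coeff (n + 3) = 0 := by
      apply Polynomial.coeff_eq_zero_of_natDegree_lt
      rw [Polynomial.natDegree_mul (by simp) (P_monic _).ne_zero, P_deg]; simp; omega
    refine ⟨?_, ?_, ?_⟩
    · rw [hP, show n + 1 + 2 = (n + 2) + 1 by ring, Polynomial.coeff_mul_X_sub_C, h1, h0]; ring
    · rw [hP, Polynomial.coeff_mul_X_sub_C, h1, h2, Fin.sum_univ_succ]; ring
    · rw [hP, Polynomial.coeff_mul_X_sub_C, h2, mul_sub, h3, Fin.sum_univ_succ, Fin.sum_univ_succ]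
      ring

lemma R_coeff {n : ℕ} (x : Fin n → ℝ) (i) : (X ^ 2 * R x i).coeff (n + 1) = 1 ∧
    ∀ k, n + 1 < k → (X ^ 2 * R x i).coeff k = 0 := by
  have hd := R_deg x i
  constructor
  · have : n + 1 = (R x i).natDegree + 2 := by omega
    rw [this, Polynomial.coeff_X_pow_mul]
    exact R_monic x i
  · intro k hk
    apply Polynomial.coeff_eq_zero_of_natDegree_lt
    rw [Polynomial.natDegree_mul (by simp) (R_monic _ _).ne_zero]; simp; omega

lemma sum_R_coeff {n : ℕ} (x b : Fin n → ℝ) :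
    (X ^ 2 * ∑ j, C (b j) * R x j).coeff (n + 1) = ∑ j, b j ∧
    ∀ k, n + 1 < k → (X ^ 2 * ∑ j, C (b j) * R x j).coeff k = 0 := by
  have h : X ^ 2 * ∑ j, C (b j) * R x j = ∑ j, C (b j) * (X ^ 2 * R x j) := by
    rw [Finset.mul_sum]; exact Finset.sum_congr rfl fun j _ => by ring
  constructor
  · rw [h, Polynomial.finsetSum_coeff]
    refine Finset.sum_congr rfl fun j _ => ?_
    rw [Polynomial.coeff_C_mul, (R_coeff x j).1, mul_one]
  · intro k hk
    rw [h, Polynomial.finsetSum_coeff]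
    refine Finset.sum_eq_zero fun j _ => ?_
    rw [Polynomial.coeff_C_mul, (R_coeff x j).2 k hk, mul_zero]

lemma degree_lt_of {p : ℝ[X]} {n : ℕ} (h : ∀ k, n + 1 < k → (X ^ 2 * p).coeff k = 0) :
    p.degree < n := by
  rw [Polynomial.degree_lt_iff_coeff_zero]
  intro m hm
  rw [← Polynomial.coeff_X_pow_mul p 2 m]
  exact h _ (by omega)

lemma P_coeff_top {n : ℕ} (x : Fin n → ℝ) : ∀ k, n + 2 < k → (X ^ 2 * P x).coeff k = 0 := by
  intro k hk
  apply Polynomial.coeff_eq_zero_of_natDegree_lt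
  rw [Polynomial.natDegree_mul (by simp) (P_monic _).ne_zero, P_deg]; simp; omega

lemma eq_of_nodes {n : ℕ} {v : Fin n → ℝ} (hv : Function.Injective v) {f g : ℝ[X]}
    (hd : (f - g).degree < n) (he : ∀ i, f.eval (v i) = g.eval (v i)) : f = g := by
  refine Polynomial.eq_of_degree_sub_lt_of_eval_index_eq (s := univ) (v := v) hv.injOn ?_
    fun i _ => he i
  simpa using hd

/-- Key identity for A -/
lemma keyA {n : ℕ} {x : Fin (n + 1) → ℝ} (hx : Function.Injective x) (s : ℝ) (y : Fin n → ℝ)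
    (c : Fin (n + 1) → ℝ) (h : ∀ i, c i * W x i = s * ∏ j, (x i - y j)) :
    C s * P y = ∑ j, C (c j) * R x j := by
  refine eq_of_nodes hx (degree_lt_of ?_) ?_
  · intro k hk
    rw [mul_sub, Polynomial.coeff_sub, (sum_R_coeff x c).2 k hk, mul_left_comm,
      Polynomial.coeff_C_mul, P_coeff_top y k (by omega)]
    simp
  · intro i
    rw [sum_R_eval, h]
    simp [P_eval]

lemma keyA_sum {n : ℕ} {x : Fin (n + 1) → ℝ} {s : ℝ} {y : Fin n → ℝ}
    {c : Fin (n + 1) → ℝ} (h : C s * P y = ∑ j, C (c j) * R x j) : s = ∑ j, c j := by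
  have := congrArg (fun p => (X ^ 2 * p).coeff (n + 1 + 1)) h
  rw [(sum_R_coeff x c).1, mul_left_comm, Polynomial.coeff_C_mul, (P_coeff y).1] at this
  linarith

lemma surjA {n : ℕ} {x : Fin (n + 1) → ℝ} (hx : StrictMono x) {c : Fin (n + 1) → ℝ}
    (hc : ∀ i, 0 < c i) : ∃ s y, 0 < s ∧ Il x y ∧ ∀ i, c i * W x i = s * ∏ j, (x i - y j) := by
  obtain ⟨y, hy, h0⟩ := exists_roots hx (F := fun t => (∑ j, C (c j) * R x j).eval t)
    (Polynomial.continuous _) (by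
      intro i
      simp only [sum_R_eval]
      rw [mul_assoc]
      exact mul_pos (hc i) (mul_self_pos.2 (W_ne hx.injective i)))
  have key : C (∑ i, c i) * P y = ∑ j, C (c j) * R x j := by
    refine eq_of_nodes hy.strictMono_right.injective (degree_lt_of ?_) ?_
    · intro k hk
      rw [mul_sub, Polynomial.coeff_sub, mul_left_comm, Polynomial.coeff_C_mul]
      rcases (Nat.succ_le_of_lt hk).eq_or_lt with h | h
      · subst h
        rw [(sum_R_coeff x c).1, (P_coeff y).1]; ring
      · rw [(sum_R_coeff x c).2 k h, P_coeff_top y k h]; ring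
    · intro i
      rw [h0, Polynomial.eval_mul, P_eval_self, mul_zero]
  refine ⟨∑ i, c i, y, Finset.sum_pos (fun i _ => hc i) univ_nonempty, hy, fun i => ?_⟩
  have := congrArg (Polynomial.eval (x i)) key
  rw [sum_R_eval, Polynomial.eval_mul, P_eval, Polynomial.eval_C] at this
  exact this.symm

lemma injA {n : ℕ} {x : Fin (n + 1) → ℝ} {s s' : ℝ} {y y' : Fin n → ℝ} (hs : 0 < s)
    (hy : Il x y) (hy' : Il x y') {c : Fin (n + 1) → ℝ}
    (h : ∀ i, c i * W x i = s * ∏ j, (x i - y j))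
    (h' : ∀ i, c i * W x i = s' * ∏ j, (x i - y' j)) : s = s' ∧ y = y' := by
  have hx := hy.strictMono_left.injective
  have k1 := keyA hx s y c h
  have k2 := keyA hx s' y' c h'
  refine ⟨(keyA_sum k1).trans (keyA_sum k2).symm, ?_⟩
  ext k
  have := congrArg (Polynomial.eval (y' k)) (k1.trans k2.symm)
  rw [Polynomial.eval_mul, Polynomial.eval_mul, P_eval_self, mul_zero, Polynomial.eval_C,
    mul_eq_zero, or_iff_right hs.ne', P_eval, Finset.prod_eq_zero_iff] at this
  obtain ⟨j, -, hj⟩ := this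
  rw [sub_eq_zero] at hj
  rcases lt_trichotomy j k with hjk | hjk | hjk
  · have a1 := hy.gt_of_gt (i := k.castSucc) (j := j) (by simpa using hjk)
    have a2 := (hy' k).1
    linarith
  · rw [hj, hjk]
  · have a1 := hy'.gt_of_gt (i := j.castSucc) (j := k) (by simpa using hjk)
    have a2 := (hy j).1
    linarith

lemma posA {n : ℕ} {x : Fin (n + 1) → ℝ} {y : Fin n → ℝ} (h : Il x y) (i) :
    0 < (∏ j, (x i - y j)) / W x i := by
  have hW : W x i = ∏ j, (x i - x (i.succAbove j)) := by
    rw [W]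
    have : (univ.erase i : Finset (Fin (n + 1))) = univ.map (Fin.succAboveEmb i) := by
      ext k; simp [Fin.exists_succAbove_eq_iff]
    rw [this, Finset.prod_map]; simp
  rw [hW, ← Finset.prod_div_distrib]
  refine Finset.prod_pos fun j _ => ?_
  rcases lt_or_ge j.castSucc i with hj | hj
  · rw [Fin.succAbove_of_castSucc_lt _ _ hj]
    exact div_pos (sub_pos.2 (h.gt_of_gt hj)) (sub_pos.2 (h.strictMono_left hj))
  · rw [Fin.succAbove_of_le_castSucc _ _ hj]
    exact div_pos_of_neg_of_neg (sub_neg.2 (h.lt_of_lt hj))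
      (sub_neg.2 (h.strictMono_left (hj.trans_lt Fin.castSucc_lt_succ)))

lemma posB {n : ℕ} {x : Fin (n + 1) → ℝ} {y : Fin n → ℝ} (h : Il x y) (j) :
    0 < - (∏ i, (y j - x i)) / W y j := by
  rw [Fin.prod_univ_succAbove _ j.castSucc, ← Finset.mul_prod_erase univ _ (mem_univ j), W]
  have h1 : 0 < (∏ k ∈ univ.erase j, (y j - x (j.castSucc.succAbove k))) /
      ∏ k ∈ univ.erase j, (y j - y k) := by
    rw [← Finset.prod_div_distrib]
    refine Finset.prod_pos fun k hk => ?_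
    rcases lt_or_gt_of_ne (Finset.ne_of_mem_erase hk) with hk | hk
    · rw [Fin.succAbove_of_castSucc_lt _ _ (by simpa using hk)]
      exact div_pos (sub_pos.2 (h.lt_of_lt (by simpa using hk.le)))
        (sub_pos.2 (h.strictMono_right hk))
    · rw [Fin.succAbove_of_le_castSucc _ _ (by simpa using hk.le)]
      exact div_pos_of_neg_of_neg (sub_neg.2 (h.gt_of_gt (by
        rw [Fin.castSucc_lt_iff_succ_le]; simpa using hk.le)))
        (sub_neg.2 (h.strictMono_right hk))
  have h2 : j.castSucc.succAbove j = j.succ := Fin.succAbove_of_le_castSucc _ _ le_rfl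
  rw [h2]
  have h3 : 0 < (y j - x j.castSucc) * (x j.succ - y j) :=
    mul_pos (by linarith [(h j).1]) (by linarith [(h j).2])
  have := mul_pos h3 h1
  have e : ∀ A B B' Q D : ℝ, -(A * ((B - B') * Q)) / D = A * (B' - B) * (Q / D) := by
    intros; ring
  rw [e]
  exact this

/-- Key identity for B -/
lemma keyB {n : ℕ} {y : Fin n → ℝ} (hy : Function.Injective y) (x : Fin (n + 1) → ℝ) (a : ℝ)
    (b : Fin n → ℝ) (ha : a = ∑ i, x i - ∑ j, y j)
    (h : ∀ j, b j * W y j = - ∏ i, (y j - x i)) :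
    P x = P y * (X - C a) - ∑ j, C (b j) * R y j := by
  refine eq_of_nodes hy (degree_lt_of ?_) ?_
  · intro k hk
    rw [mul_sub, mul_sub, Polynomial.coeff_sub, Polynomial.coeff_sub, (sum_R_coeff y b).2 k hk,
      ← mul_assoc]
    obtain ⟨k, rfl⟩ : ∃ l, k = l + 1 := ⟨k - 1, by omega⟩
    rw [Polynomial.coeff_mul_X_sub_C]
    rcases lt_trichotomy k (n + 2) with h | h | h
    · obtain rfl : k = n + 1 := by omega
      rw [(P_coeff x).2.1, (P_coeff y).1, (P_coeff y).2.1, ha]; ring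
    · subst h
      have := (P_coeff x).1
      rw [show n + 1 + 2 = n + 2 + 1 by ring] at this
      rw [this, (P_coeff y).1, P_coeff_top y _ (by omega)]; ring
    · rw [P_coeff_top x _ (by omega), P_coeff_top y _ (by omega), P_coeff_top y _ (by omega)]; ring
  · intro j
    rw [Polynomial.eval_sub, sum_R_eval, h, Polynomial.eval_mul, P_eval_self, P_eval]
    ring

lemma keyB_sum {n : ℕ} {y : Fin n → ℝ} {x : Fin (n + 1) → ℝ} {a : ℝ}
    {b : Fin n → ℝ} (h : P x = P y * (X - C a) - ∑ j, C (b j) * R y j) :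
    a = ∑ i, x i - ∑ j, y j ∧ ∑ i, x i ^ 2 = ∑ j, y j ^ 2 + a ^ 2 + 2 * ∑ j, b j := by
  have e1 := congrArg (fun p => (X ^ 2 * p).coeff (n + 1 + 1)) h
  have e2 := congrArg (fun p => (X ^ 2 * p).coeff (n + 1)) h
  simp only [mul_sub (X ^ 2 : ℝ[X]), Polynomial.coeff_sub, ← mul_assoc] at e1 e2
  rw [Polynomial.coeff_mul_X_sub_C, (P_coeff x).2.1, (P_coeff y).1, (P_coeff y).2.1,
    (sum_R_coeff y b).2 _ (by omega)] at e1
  rw [Polynomial.coeff_mul_X_sub_C, (P_coeff y).2.1, (sum_R_coeff y b).1] at e2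
  have e3 := (P_coeff x).2.2
  have e4 := (P_coeff y).2.2
  have ha : a = ∑ i, x i - ∑ j, y j := by linarith
  refine ⟨ha, ?_⟩
  have : ∑ i, x i = a + ∑ j, y j := by linarith
  rw [this] at e3
  linear_combination e3 - 2 * e2 - e4

lemma injB {n : ℕ} {y : Fin n → ℝ} {x x' : Fin (n + 1) → ℝ} {b : Fin n → ℝ} {a : ℝ}
    (hx : Il x y) (hx' : Il x' y) (ha : a = ∑ i, x i - ∑ j, y j)
    (ha' : a = ∑ i, x' i - ∑ j, y j)
    (h : ∀ j, b j * W y j = - ∏ i, (y j - x i))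
    (h' : ∀ j, b j * W y j = - ∏ i, (y j - x' i)) : x = x' := by
  have hy := hx.strictMono_right.injective
  have k := (keyB hy x a b ha h).trans (keyB hy x' a b ha' h').symm
  ext i
  have := congrArg (Polynomial.eval (x' i)) k
  rw [P_eval_self, P_eval, Finset.prod_eq_zero_iff] at this
  obtain ⟨j, -, hj⟩ := this
  rw [sub_eq_zero] at hj
  rcases lt_trichotomy j i with hji | hji | hji
  · obtain ⟨l, rfl⟩ := Fin.exists_castSucc_eq.2 (ne_of_lt (lt_of_lt_of_le hji (Fin.le_last i)))
    have a1 := hx'.gt_of_gt hji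
    have a2 := (hx l).1
    linarith
  · rw [hj, hji]
  · obtain ⟨l, rfl⟩ := Fin.exists_castSucc_eq.2 (ne_of_lt (lt_of_lt_of_le hji (Fin.le_last j)))
    have a1 := hx.gt_of_gt hji
    have a2 := (hx' l).1
    linarith

lemma W_eq_ite {n : ℕ} (x : Fin n → ℝ) (i) : W x i = ∏ k, if k = i then 1 else (x i - x k) := by
  rw [W, ← Finset.mul_prod_erase univ _ (mem_univ i)]
  simp only [if_true, one_mul]
  refine Finset.prod_congr rfl fun k hk => ?_
  rw [if_neg (Finset.ne_of_mem_erase hk)]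

lemma surjB {n : ℕ} {y : Fin n → ℝ} (hy : StrictMono y) (a : ℝ) {b : Fin n → ℝ}
    (hb : ∀ j, 0 < b j) : ∃ x, Il x y ∧ a = ∑ i, x i - ∑ j, y j ∧
      ∀ j, b j * W y j = - ∏ i, (y j - x i) := by
  set F : ℝ[X] := P y * (X - C a) - ∑ j, C (b j) * R y j with hF
  have hB : 0 ≤ ∑ j, b j := Finset.sum_nonneg fun j _ => (hb j).le
  have hFe : ∀ t, (∀ j, y j ≠ t) → F.eval t = (∏ j, (t - y j)) * (t - a - ∑ j, b j / (t - y j)) := by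
    intro t ht
    rw [hF, Polynomial.eval_sub, Polynomial.eval_mul, P_eval, Polynomial.eval_finsetSum, mul_sub,
      Finset.mul_sum]
    congr 1
    · simp
    · refine Finset.sum_congr rfl fun j _ => ?_
      rw [Polynomial.eval_mul, R_eval, ← Finset.mul_prod_erase univ _ (mem_univ j)]
      have := sub_ne_zero.2 (ht j).symm
      simp
      field_simp
  obtain ⟨T, hT1, hT2⟩ : ∃ T : ℝ, (∀ j, |y j| + 1 ≤ T) ∧ |a| + ∑ j, b j < T := by
    refine ⟨∑ j, |y j| + 1 + (|a| + ∑ j, b j), fun j => ?_, ?_⟩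
    · have := Finset.single_le_sum (f := fun j => |y j|) (fun i _ => abs_nonneg _) (mem_univ j)
      have := abs_nonneg a
      linarith
    · have : 0 ≤ ∑ j, |y j| := Finset.sum_nonneg fun j _ => abs_nonneg _
      linarith
  have hT0 : 0 < T := by have := abs_nonneg a; linarith
  have hR : ∀ j, 1 ≤ T - y j := fun j => by have := le_abs_self (y j); linarith [hT1 j]
  have hL : ∀ j, 1 ≤ y j - (-T) := fun j => by have := neg_abs_le (y j); linarith [hT1 j]
  have hsR : ∑ j, b j / (T - y j) ≤ ∑ j, b j :=
    Finset.sum_le_sum fun j _ => div_le_self (hb j).le (hR j)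
  have hsL : ∑ j, b j / (y j - (-T)) ≤ ∑ j, b j :=
    Finset.sum_le_sum fun j _ => div_le_self (hb j).le (hL j)
  have hRpos : 0 < T - a - ∑ j, b j / (T - y j) := by have := le_abs_self a; linarith
  have hLneg : (-T) - a - ∑ j, b j / (-T - y j) < 0 := by
    have e : ∑ j, b j / (-T - y j) = - ∑ j, b j / (y j - (-T)) := by
      rw [← Finset.sum_neg_distrib]
      refine Finset.sum_congr rfl fun j _ => ?_
      rw [← div_neg]; congr 1; ring
    have := neg_abs_le a
    linarith
  set z : Fin (n + 2) → ℝ := Fin.cons (-T) (Fin.snoc y T : Fin (n + 1) → ℝ) with hz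
  have z0 : z 0 = -T := by simp [hz]
  have z1 : z (Fin.last (n + 1)) = T := by
    rw [hz, ← Fin.succ_last, Fin.cons_succ, Fin.snoc_last]
  have z2 : ∀ j : Fin n, z j.castSucc.succ = y j := by
    intro j; rw [hz, Fin.cons_succ, Fin.snoc_castSucc]
  have zm : StrictMono z := by
    intro i j
    refine Fin.cases ?_ (fun i => ?_) i <;> refine Fin.cases ?_ (fun j => ?_) j
    · simp
    · refine Fin.lastCases (fun _ => ?_) (fun j _ => ?_) j
      · rw [Fin.succ_last, z1, z0]; linarith
      · rw [z2, z0]; linarith [hL j]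
    · simp
    · refine Fin.lastCases ?_ (fun j => ?_) j <;> refine Fin.lastCases ?_ (fun i => ?_) i
      · simp
      · intro _
        rw [Fin.succ_last, z1, z2]; linarith [hR i]
      · intro h
        have := Fin.le_last j.castSucc.succ
        rw [Fin.succ_last] at h
        exact absurd h (not_lt.2 this)
      · intro h
        rw [z2, z2]
        exact hy (by simpa using h)
  have hpos : ∀ i, 0 < F.eval (z i) * W z i := by
    intro i
    refine Fin.cases ?_ (fun i => ?_) i
    · have w : W z 0 = (∏ j, (-T - y j)) * (-T - T) := by
        rw [W_eq_ite, Fin.prod_univ_succ, Fin.prod_univ_castSucc]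
        simp only [z0, z2, Fin.succ_last, z1]
        have : (Fin.last (n + 1)) ≠ 0 := Fin.last_pos.ne'
        simp [Fin.succ_ne_zero, this]
      have hne : (∏ j, (-T - y j)) ≠ 0 := Finset.prod_ne_zero_iff.2 fun j _ => by
        have := hL j; intro h; linarith
      rw [w, z0, hFe _ (fun j => by have := hL j; intro h; linarith)]
      have h1 := mul_self_pos.2 hne
      have h2 := mul_pos_of_neg_of_neg hLneg (show -T - T < 0 by linarith)
      have := mul_pos h1 h2
      linarith
    · refine Fin.lastCases ?_ (fun i => ?_) i
      · have w : W z (Fin.last (n + 1)) = (T + T) * (∏ j, (T - y j)) := by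
          rw [W_eq_ite, Fin.prod_univ_succ, Fin.prod_univ_castSucc]
          simp only [z0, z2, Fin.succ_last, z1]
          have h1 : (0 : Fin (n + 2)) ≠ Fin.last (n + 1) := Fin.last_pos.ne
          have h2 : ∀ j : Fin n, j.castSucc.succ ≠ Fin.last (n + 1) := by
            intro j h
            rw [← Fin.succ_last, Fin.succ_inj] at h
            exact (Fin.castSucc_lt_last j).ne h
          simp [h1, h2]
        have hne : (∏ j, (T - y j)) ≠ 0 := Finset.prod_ne_zero_iff.2 fun j _ => by
          have := hR j; intro h; linarith
        rw [Fin.succ_last, w, z1, hFe _ (fun j => by have := hR j; intro h; linarith)]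
        have h1 := mul_self_pos.2 hne
        have h2 := mul_pos hRpos (show 0 < T + T by linarith)
        have := mul_pos h1 h2
        linarith
      · have w : W z i.castSucc.succ = (y i + T) * (W y i * (y i - T)) := by
          rw [W_eq_ite, Fin.prod_univ_succ, Fin.prod_univ_castSucc, W_eq_ite y]
          simp only [z0, z2, Fin.succ_last, z1]
          have h1 : (0 : Fin (n + 2)) ≠ i.castSucc.succ := (Fin.succ_ne_zero _).symm
          have h2 : Fin.last (n + 1) ≠ i.castSucc.succ := by
            intro h
            rw [← Fin.succ_last, Fin.succ_inj] at h
            exact (Fin.castSucc_lt_last i).ne' h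
          simp [h1, h2]
        have e : F.eval (y i) = - (b i * W y i) := by
          rw [hF, Polynomial.eval_sub, sum_R_eval, Polynomial.eval_mul, P_eval_self]; ring
        rw [w, z2, e]
        have h1 := mul_pos (hb i) (mul_self_pos.2 (W_ne hy.injective i))
        have h2 : 0 < (y i + T) * (T - y i) :=
          mul_pos (by linarith [hL i]) (by linarith [hR i])
        have := mul_pos h1 h2
        linarith
  obtain ⟨r, hr, h0⟩ := exists_roots zm (F := fun t => F.eval t) (Polynomial.continuous _) hpos
  have hil : Il r y := by
    intro j
    have a1 := (hr j.castSucc).2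
    have a2 := (hr j.succ).1
    rw [← Fin.succ_castSucc] at a2
    rw [z2] at a1 a2
    exact ⟨a1, a2⟩
  have key : P r = F := by
    refine eq_of_nodes hil.strictMono_left.injective (degree_lt_of ?_) ?_
    · intro k hk
      rw [hF, mul_sub, mul_sub, Polynomial.coeff_sub, Polynomial.coeff_sub,
        (sum_R_coeff y b).2 k (by omega), ← mul_assoc]
      obtain ⟨k, rfl⟩ : ∃ l, k = l + 1 := ⟨k - 1, by omega⟩
      rw [Polynomial.coeff_mul_X_sub_C]
      rcases (show n + 2 ≤ k by omega).eq_or_lt with h | h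
      · subst h
        have := (P_coeff r).1
        rw [show n + 1 + 2 = n + 2 + 1 by ring] at this
        rw [this, (P_coeff y).1, P_coeff_top y _ (by omega)]; ring
      · rw [P_coeff_top r _ (by omega), P_coeff_top y _ (by omega), P_coeff_top y _ (by omega)]
        ring
    · intro i
      rw [P_eval_self]; exact (h0 i).symm
  refine ⟨r, hil, (keyB_sum key).1, fun j => ?_⟩
  have := congrArg (Polynomial.eval (y j)) key
  rw [hF, Polynomial.eval_sub, sum_R_eval, Polynomial.eval_mul, P_eval_self, P_eval] at this
  linarith

end Mehta

open Real MeasureTheory Finset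
namespace Mehta
open scoped ENNReal

lemma lint_cons {n : ℕ} {f : ℝ → ℝ≥0∞} {g : (Fin n → ℝ) → ℝ≥0∞} (hf : Measurable f)
    (hg : Measurable g) : ∫⁻ z : Fin (n + 1) → ℝ, f (z 0) * g (fun j => z j.succ) =
      (∫⁻ t, f t) * ∫⁻ y, g y := by
  have h := volume_preserving_piFinSuccAbove (fun _ : Fin (n + 1) => ℝ) 0
  rw [← lintegral_prod_mul hf.aemeasurable hg.aemeasurable,
    ← Measure.volume_eq_prod, ← h.lintegral_comp_emb (MeasurableEquiv.measurableEmbedding _)]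
  rfl

lemma lint_pow {f : ℝ → ℝ≥0∞} (hf : Measurable f) (n : ℕ) :
    ∫⁻ z : Fin n → ℝ, ∏ i, f (z i) = (∫⁻ t, f t) ^ n := by
  induction n with
  | zero => simp [volume_pi]
  | succ n ih =>
    simp_rw [Fin.prod_univ_succ]
    rw [lint_cons (g := fun y : Fin n → ℝ => ∏ i, f (y i)) hf (by fun_prop), ih, pow_succ']

noncomputable def gam (r γ : ℝ) : ℝ → ℝ≥0∞ :=
  (Set.Ioi 0).indicator fun t => ENNReal.ofReal (t ^ (γ - 1) * Real.exp (-(r * t)))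

lemma gam_meas (r γ : ℝ) : Measurable (gam r γ) :=
  Measurable.indicator (by fun_prop) measurableSet_Ioi

lemma gam_lint {r γ : ℝ} (hr : 0 < r) (hγ : 0 < γ) :
    ∫⁻ t, gam r γ t = ENNReal.ofReal ((1 / r) ^ γ * Real.Gamma γ) := by
  rw [gam, lintegral_indicator measurableSet_Ioi, ← Real.integral_rpow_mul_exp_neg_mul_Ioi hγ hr,
    ofReal_integral_eq_lintegral_ofReal]
  · by_contra h
    have := integral_undef h
    rw [Real.integral_rpow_mul_exp_neg_mul_Ioi hγ hr] at this
    have h2 := Real.Gamma_pos_of_pos hγ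
    have : 0 < (1 / r) ^ γ * Real.Gamma γ := by positivity
    linarith
  · filter_upwards [ae_restrict_mem measurableSet_Ioi] with t ht
    have : (0 : ℝ) < t := ht
    positivity

lemma gauss_lint : ∫⁻ t : ℝ, ENNReal.ofReal (Real.exp (-t ^ 2)) = ENNReal.ofReal √π := by
  have h1 := integral_gaussian 1
  have h2 := integrable_exp_neg_mul_sq (b := 1) one_pos
  simp only [div_one, neg_mul, one_mul] at h1 h2
  rw [← ofReal_integral_eq_lintegral_ofReal h2 (by filter_upwards with t; positivity), h1]

lemma hasFDerivAt_matrix {m : ℕ} {f : (Fin m → ℝ) → (Fin m → ℝ)} {D : Matrix (Fin m) (Fin m) ℝ}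
    {z : Fin m → ℝ} (h : ∀ i, HasFDerivAt (fun z => f z i)
      (∑ k, D i k • (ContinuousLinearMap.proj k : (Fin m → ℝ) →L[ℝ] ℝ)) z) :
    HasFDerivAt f (LinearMap.toContinuousLinearMap (Matrix.toLin' D)) z := by
  rw [hasFDerivAt_pi']
  intro i
  refine (h i).congr_fderiv ?_
  ext v
  simp [Matrix.mulVec, dotProduct]

lemma det_toLin {m : ℕ} (D : Matrix (Fin m) (Fin m) ℝ) :
    (LinearMap.toContinuousLinearMap (Matrix.toLin' D)).det = D.det := by
  rw [ContinuousLinearMap.det]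
  simp

/-- map A -/
noncomputable def PhiA {n : ℕ} (x : Fin (n + 1) → ℝ) (z : Fin (n + 1) → ℝ) (i : Fin (n + 1)) : ℝ :=
  z 0 * (∏ j : Fin n, (x i - z j.succ)) / W x i

/-- Jacobian matrix of A -/
noncomputable def DA {n : ℕ} (x : Fin (n + 1) → ℝ) (z : Fin (n + 1) → ℝ) :
    Matrix (Fin (n + 1)) (Fin (n + 1)) ℝ :=
  Matrix.of fun i => Fin.cons ((∏ j : Fin n, (x i - z j.succ)) / W x i)
    (fun j => - (z 0 * ∏ k ∈ univ.erase j, (x i - z k.succ)) / W x i)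

lemma PhiA_deriv {n : ℕ} (x z : Fin (n + 1) → ℝ) :
    HasFDerivAt (PhiA x) (LinearMap.toContinuousLinearMap (Matrix.toLin' (DA x z))) z := by
  apply hasFDerivAt_matrix
  intro i
  have h0 : ∀ k : Fin (n + 1), HasFDerivAt (fun z : Fin (n + 1) → ℝ => z k)
    (ContinuousLinearMap.proj k : (Fin (n + 1) → ℝ) →L[ℝ] ℝ) z := fun k => hasFDerivAt_apply k z
  have h1 := HasFDerivAt.finsetProd (u := univ) (x := z)
    (g := fun (j : Fin n) (z : Fin (n + 1) → ℝ) => x i - z j.succ)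
    (fun j _ => (h0 j.succ).const_sub (x i))
  have h2 := ((h0 0).mul h1).mul_const (W x i)⁻¹
  refine (h2.congr_fderiv ?_).congr_of_eventuallyEq ?_
  · ext v
    simp [DA, Fin.sum_univ_succ, Finset.mul_sum, mul_add, div_eq_mul_inv]
    rw [add_comm]
    congr 1
    · ring
    · rw [neg_inj]
      exact Finset.sum_congr rfl fun j _ => by ring
  · filter_upwards with w
    simp [PhiA, div_eq_mul_inv]

lemma DA_det {n : ℕ} {x z : Fin (n + 1) → ℝ} (h0 : 0 < z 0) (h : Il x (fun j => z j.succ)) :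
    |(DA x z).det| * (z 0 * Pr x (fun j => z j.succ)) =
      (∏ i, PhiA x z i) * (V x * V (fun j => z j.succ)) := by
  have e : DA x z = Matrix.diagonal (PhiA x z) * M x (fun j => z j.succ) *
      Matrix.diagonal (Fin.cons (z 0)⁻¹ (fun _ => -1)) := by
    ext i j
    rw [Matrix.mul_diagonal, Matrix.diagonal_mul]
    refine Fin.cases ?_ (fun j => ?_) j
    · simp [DA, M, PhiA]; field_simp
    · simp only [DA, M, PhiA, Matrix.of_apply, Fin.cons_succ]
      rw [← Finset.mul_prod_erase univ (fun j : Fin n => x i - z j.succ) (mem_univ j)]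
      have := sub_ne_zero.2 (h.ne i j)
      field_simp
  have hp : 0 < ∏ i, PhiA x z i := Finset.prod_pos fun i _ => by
    rw [PhiA, mul_div_assoc]; exact mul_pos h0 (posA h i)
  rw [← det_M h.strictMono_right.injective h.ne, e, Matrix.det_mul, Matrix.det_mul,
    Matrix.det_diagonal, Matrix.det_diagonal, abs_mul, abs_mul, abs_of_pos hp, Fin.prod_univ_succ
    (f := (Fin.cons (z 0)⁻¹ (fun _ => -1) : Fin (n + 1) → ℝ))]
  simp [abs_mul, abs_of_pos h0]
  field_simp

lemma PhiA_prod {n : ℕ} {x z : Fin (n + 1) → ℝ} (h0 : 0 < z 0) (h : Il x (fun j => z j.succ)) :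
    ∏ i, PhiA x z i = z 0 ^ (n + 1) * Pr x (fun j => z j.succ) / V x ^ 2 := by
  have : ∀ i, PhiA x z i = z 0 * (∏ j : Fin n, |x i - z j.succ|) / |W x i| := by
    intro i
    have h1 := posA h i
    rw [← abs_of_pos h1, abs_div, Finset.abs_prod] at h1
    rw [PhiA, mul_div_assoc, ← abs_of_pos (posA h i), abs_div, Finset.abs_prod, mul_div_assoc]
  simp_rw [this]
  rw [Finset.prod_div_distrib, Finset.prod_mul_distrib, prod_W]
  simp [Pr]

lemma rpowA (n : ℕ) {s p v : ℝ} (w γ : ℝ) (hs : 0 < s) (hp : 0 < p) (hv : 0 < v) :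
    s ^ n * (w / v) * (s ^ (n + 1) * p / v ^ 2) ^ (γ - 1) =
      s ^ ((n + 1) * γ - 1) * (v ^ (1 - 2 * γ) * w * p ^ (γ - 1)) := by
  rw [Real.div_rpow (by positivity) (by positivity), Real.mul_rpow (by positivity) hp.le,
    ← Real.rpow_natCast s (n + 1), ← Real.rpow_natCast v 2, ← Real.rpow_mul hs.le,
    ← Real.rpow_mul hv.le, ← Real.rpow_natCast s n,
    show ((n : ℝ) + 1) * γ - 1 = (n : ℝ) + ((n + 1 : ℕ) : ℝ) * (γ - 1) by push_cast; ring,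
    Real.rpow_add hs, show 1 - 2 * γ = -1 - ((2 : ℕ) : ℝ) * (γ - 1) by push_cast; ring,
    Real.rpow_sub hv, Real.rpow_neg_one]
  field_simp

lemma Il_meas {n : ℕ} : MeasurableSet {p : (Fin (n + 1) → ℝ) × (Fin n → ℝ) | Il p.1 p.2} := by
  unfold Il
  simp only [Set.ofPred_forall, Set.ofPred_and]
  refine MeasurableSet.iInter fun i => MeasurableSet.inter ?_ ?_
  · exact measurableSet_lt (by fun_prop) (by fun_prop)
  · exact measurableSet_lt (by fun_prop) (by fun_prop)

lemma V_meas {n : ℕ} : Measurable (V : (Fin n → ℝ) → ℝ) := by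
  unfold V; fun_prop

lemma Pr_meas {n m : ℕ} : Measurable (fun p : (Fin m → ℝ) × (Fin n → ℝ) => Pr p.1 p.2) := by
  unfold Pr; fun_prop

/-- integrand on the y side -/
noncomputable def hA {n : ℕ} (γ : ℝ) (x : Fin (n + 1) → ℝ) (y : Fin n → ℝ) : ℝ≥0∞ :=
  {y | Il x y}.indicator (fun y => ENNReal.ofReal (V x ^ (1 - 2 * γ) * V y * Pr x y ^ (γ - 1))) y

lemma hA_meas {n : ℕ} (γ : ℝ) (x : Fin (n + 1) → ℝ) : Measurable (hA γ x) := by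
  refine Measurable.indicator ?_ ?_
  · have := (Pr_meas (n := n) (m := n + 1)).comp (measurable_prodMk_left (x := x))
    have h2 := V_meas (n := n)
    simp only [Function.comp_def] at this
    fun_prop
  · exact Il_meas.preimage (measurable_prodMk_left (x := x))

lemma mainA {n : ℕ} {γ : ℝ} (hγ : 0 < γ) {x : Fin (n + 1) → ℝ} (hx : StrictMono x) :
    ENNReal.ofReal (Real.Gamma γ) ^ (n + 1) =
      ENNReal.ofReal (Real.Gamma ((n + 1) * γ)) * ∫⁻ y, hA γ x y := by
  have g1 := gam_lint (r := 1) one_pos hγ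
  have g2 := gam_lint (r := 1) (γ := (n + 1) * γ) one_pos (by positivity)
  simp only [div_one, Real.one_rpow, one_mul] at g1 g2
  rw [← g1, ← g2, ← lint_pow (gam_meas 1 γ), ← lint_cons (gam_meas _ _) (hA_meas γ x)]
  set S : Set (Fin (n + 1) → ℝ) := {z | 0 < z 0 ∧ Il x (fun j => z j.succ)} with hS
  have hSm : MeasurableSet S := by
    rw [hS, Set.ofPred_and]
    refine MeasurableSet.inter (measurableSet_lt (by fun_prop) (by fun_prop)) ?_
    have : Measurable (fun z : Fin (n + 1) → ℝ => (x, fun j : Fin n => z j.succ)) := by fun_prop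
    exact Il_meas.preimage this
  have hrel : ∀ z i, PhiA x z i * W x i = z 0 * ∏ j : Fin n, (x i - z j.succ) := by
    intro z i
    have := W_ne hx.injective i
    rw [PhiA]; field_simp
  have himg : PhiA x '' S = {c | ∀ i, 0 < c i} := by
    ext c
    constructor
    · rintro ⟨z, hz, rfl⟩ i
      rw [PhiA, mul_div_assoc]; exact mul_pos hz.1 (posA hz.2 i)
    · intro hc
      obtain ⟨s, y, hs, hy, h⟩ := surjA hx hc
      refine ⟨Fin.cons s y, ⟨by simpa using hs, by simpa using hy⟩, ?_⟩
      ext i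
      have h1 := hrel (Fin.cons s y) i
      simp only [Fin.cons_zero, Fin.cons_succ] at h1
      rw [← h i] at h1
      exact mul_right_cancel₀ (W_ne hx.injective i) h1
  have hinj : Set.InjOn (PhiA x) S := by
    intro z hz z' hz' h
    obtain ⟨h1, h2⟩ := injA (c := PhiA x z) hz.1 hz.2 hz'.2 (hrel z) (by rw [h]; exact hrel z')
    ext i
    refine Fin.cases h1 (fun j => congrFun h2 j) i
  have hcv := lintegral_image_eq_lintegral_abs_det_fderiv_mul volume hSm
    (fun z _ => (PhiA_deriv x z).hasFDerivWithinAt) hinj (fun c => ∏ i, gam 1 γ (c i))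
  have hTm : MeasurableSet {c : Fin (n + 1) → ℝ | ∀ i, 0 < c i} := by
    rw [Set.ofPred_forall]
    exact MeasurableSet.iInter fun i => measurableSet_lt (by fun_prop) (by fun_prop)
  rw [himg, ← lintegral_indicator hTm, ← lintegral_indicator hSm] at hcv
  refine Eq.trans ?_ (hcv.trans ?_)
  · refine lintegral_congr fun c => ?_
    by_cases hc : c ∈ {c : Fin (n + 1) → ℝ | ∀ i, 0 < c i}
    · rw [Set.indicator_of_mem hc]
    · rw [Set.indicator_of_notMem hc]
      simp only [Set.mem_ofPred_eq, not_forall] at hc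
      obtain ⟨i, hi⟩ := hc
      exact Finset.prod_eq_zero (mem_univ i) (Set.indicator_of_notMem hi _)
  · refine lintegral_congr fun z => ?_
    by_cases hz : z ∈ S
    · rw [Set.indicator_of_mem hz]
      obtain ⟨h0, hI⟩ := hz
      have hpos : ∀ i, 0 < PhiA x z i := fun i => by
        rw [PhiA, mul_div_assoc]; exact mul_pos h0 (posA hI i)
      have e1 : ∀ i, gam 1 γ (PhiA x z i) =
          ENNReal.ofReal (PhiA x z i ^ (γ - 1) * Real.exp (-(1 * PhiA x z i))) := fun i =>
        Set.indicator_of_mem (hpos i) _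
      have e2 : gam 1 ((n + 1) * γ) (z 0) =
          ENNReal.ofReal (z 0 ^ ((n + 1) * γ - 1) * Real.exp (-(1 * z 0))) :=
        Set.indicator_of_mem h0 _
      have e3 : hA γ x (fun j => z j.succ) = ENNReal.ofReal (V x ^ (1 - 2 * γ) *
          V (fun j => z j.succ) * Pr x (fun j => z j.succ) ^ (γ - 1)) :=
        Set.indicator_of_mem (show (fun j => z j.succ) ∈ {y | Il x y} from hI) _
      simp only [e1]
      rw [e2, e3, det_toLin, ← ENNReal.ofReal_prod_of_nonneg (fun i _ => by
        have := hpos i; positivity), ← ENNReal.ofReal_mul (abs_nonneg _),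
        ← ENNReal.ofReal_mul (by positivity)]
      congr 1
      have hVx := V_pos hx.injective
      have hPr := hI.Pr_pos
      have hsum := keyA_sum (keyA hx.injective (z 0) _ _ (hrel z))
      rw [Finset.prod_mul_distrib, Real.finsetProd_rpow _ _ (fun i _ => (hpos i).le),
        ← Real.exp_sum, one_mul]
      have e4 : ∑ i, -(1 * PhiA x z i) = - z 0 := by simp [← hsum]
      have e5 := DA_det h0 hI
      rw [PhiA_prod h0 hI] at e5 ⊢
      have e6 : |(DA x z).det| = z 0 ^ n * (V (fun j => z j.succ) / V x) := by
        have : 0 < z 0 * Pr x (fun j => z j.succ) := mul_pos h0 hPr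
        apply mul_right_cancel₀ this.ne'
        rw [e5]; field_simp; ring
      rw [e4, e6, ← mul_assoc, rpowA n _ γ h0 hPr hVx]
      ring
    · rw [Set.indicator_of_notMem hz]
      symm
      rw [hS, Set.mem_ofPred_eq, not_and_or] at hz
      rcases hz with hz | hz
      · rw [gam, Set.indicator_of_notMem (by simpa using hz), zero_mul]
      · rw [hA, Set.indicator_of_notMem (by simpa using hz), mul_zero]

end Mehta

open Real MeasureTheory Finset
namespace Mehta
open scoped ENNReal

/-- map B -/
noncomputable def PhiB {n : ℕ} (y : Fin n → ℝ) (x : Fin (n + 1) → ℝ) : Fin (n + 1) → ℝ :=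
  Fin.cons (∑ i, x i - ∑ j, y j) (fun j => - (∏ i, (y j - x i)) / W y j)

/-- Jacobian matrix of B -/
noncomputable def DB {n : ℕ} (y : Fin n → ℝ) (x : Fin (n + 1) → ℝ) :
    Matrix (Fin (n + 1)) (Fin (n + 1)) ℝ :=
  Matrix.of (Fin.cons (fun _ => 1) (fun j i => (∏ k ∈ univ.erase i, (y j - x k)) / W y j))

lemma PhiB_deriv {n : ℕ} (y : Fin n → ℝ) (x : Fin (n + 1) → ℝ) :
    HasFDerivAt (PhiB y) (LinearMap.toContinuousLinearMap (Matrix.toLin' (DB y x))) x := by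
  apply hasFDerivAt_matrix
  intro i
  have h0 : ∀ k : Fin (n + 1), HasFDerivAt (fun z : Fin (n + 1) → ℝ => z k)
    (ContinuousLinearMap.proj k : (Fin (n + 1) → ℝ) →L[ℝ] ℝ) x := fun k => hasFDerivAt_apply k x
  refine Fin.cases ?_ (fun j => ?_) i
  · have h1 := (HasFDerivAt.fun_sum (u := univ) (fun k _ => h0 k)).sub_const (∑ j, y j)
    refine (h1.congr_fderiv ?_).congr_of_eventuallyEq ?_
    · ext v
      simp [DB]
    · filter_upwards with w
      simp [PhiB]
  · have h1 := HasFDerivAt.finsetProd (u := univ) (x := x)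
      (g := fun (i : Fin (n + 1)) (z : Fin (n + 1) → ℝ) => y j - z i)
      (fun i _ => (h0 i).const_sub (y j))
    have h2 := (h1.neg).mul_const (W y j)⁻¹
    refine (h2.congr_fderiv ?_).congr_of_eventuallyEq ?_
    · ext v
      simp [DB, Finset.mul_sum, div_eq_mul_inv]
      exact Finset.sum_congr rfl fun j _ => by ring
    · filter_upwards with w
      simp [PhiB, div_eq_mul_inv]

lemma PhiB_prod {n : ℕ} {y : Fin n → ℝ} {x : Fin (n + 1) → ℝ} (h : Il x y) :
    ∏ j : Fin n, PhiB y x j.succ = Pr x y / V y ^ 2 := by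
  have : ∀ j : Fin n, PhiB y x j.succ = (∏ i, |x i - y j|) / |W y j| := by
    intro j
    have h1 := posB h j
    rw [PhiB, Fin.cons_succ, ← abs_of_pos h1, abs_div, abs_neg, Finset.abs_prod]
    simp_rw [abs_sub_comm]
  simp_rw [this]
  rw [Finset.prod_div_distrib, prod_W, Pr, Finset.prod_comm]

lemma DB_det {n : ℕ} {y : Fin n → ℝ} {x : Fin (n + 1) → ℝ} (h : Il x y) :
    |(DB y x).det| = V x / V y := by
  have e : DB y x = Matrix.diagonal (Fin.cons 1 (fun j => PhiB y x j.succ)) *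
      (M x y).transpose := by
    ext i k
    rw [Matrix.diagonal_mul]
    refine Fin.cases ?_ (fun j => ?_) i
    · simp [DB, M]
    · simp only [DB, M, PhiB, Matrix.of_apply, Fin.cons_succ, Matrix.transpose_apply]
      rw [← Finset.mul_prod_erase univ (fun i => y j - x i) (mem_univ k)]
      have := sub_ne_zero.2 (h.ne k j)
      field_simp
      ring
  have hp : 0 < ∏ j : Fin n, PhiB y x j.succ := Finset.prod_pos fun i _ => by
    rw [PhiB, Fin.cons_succ]; exact posB h i
  have hd := det_M h.strictMono_right.injective h.ne
  have hV := V_pos h.strictMono_right.injective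
  have hPr := h.Pr_pos
  rw [e, Matrix.det_mul, Matrix.det_transpose, Matrix.det_diagonal, abs_mul, Fin.prod_univ_succ]
  simp only [Fin.cons_zero, Fin.cons_succ, one_mul]
  rw [abs_of_pos hp, PhiB_prod h]
  apply mul_right_cancel₀ hPr.ne'
  rw [mul_assoc, hd]
  field_simp

/-- integrand on the x side -/
noncomputable def hB {n : ℕ} (γ : ℝ) (y : Fin n → ℝ) (x : Fin (n + 1) → ℝ) : ℝ≥0∞ :=
  {x | Il x y}.indicator (fun x => ENNReal.ofReal (V y ^ (1 - 2 * γ) * Real.exp (∑ j, y j ^ 2) *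
    (V x * Pr x y ^ (γ - 1) * Real.exp (-∑ i, x i ^ 2)))) x

lemma rpowB {p v : ℝ} (w γ : ℝ) (hp : 0 < p) (hv : 0 < v) :
    (w / v) * (p / v ^ 2) ^ (γ - 1) = v ^ (1 - 2 * γ) * w * p ^ (γ - 1) := by
  have := rpowA 0 (s := 1) w γ one_pos hp hv
  simpa using this

lemma mainB {n : ℕ} {γ : ℝ} (hγ : 0 < γ) {y : Fin n → ℝ} (hy : StrictMono y) :
    ENNReal.ofReal √π * ENNReal.ofReal ((1 / 2) ^ γ * Real.Gamma γ) ^ n = ∫⁻ x, hB γ y x := by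
  have hgm : Measurable fun t : ℝ => ENNReal.ofReal (Real.exp (-t ^ 2)) := by fun_prop
  have hgm2 : Measurable fun z : Fin n → ℝ => ∏ i, gam 2 γ (z i) := by
    have := gam_meas 2 γ
    fun_prop
  rw [← gam_lint two_pos hγ, ← gauss_lint, ← lint_pow (gam_meas 2 γ), ← lint_cons hgm hgm2]
  set S : Set (Fin (n + 1) → ℝ) := {x | Il x y} with hS
  have hSm : MeasurableSet S := by
    have : Measurable (fun x : Fin (n + 1) → ℝ => (x, y)) := by fun_prop
    exact Il_meas.preimage this
  have hrel0 : ∀ x, PhiB y x 0 = ∑ i, x i - ∑ j, y j := fun x => by simp [PhiB]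
  have hrel : ∀ x (j : Fin n), PhiB y x j.succ * W y j = - ∏ i, (y j - x i) := by
    intro x j
    have := W_ne hy.injective j
    rw [PhiB, Fin.cons_succ]; field_simp
  have himg : PhiB y '' S = {c | ∀ j : Fin n, 0 < c j.succ} := by
    ext c
    constructor
    · rintro ⟨x, hx, rfl⟩ i
      rw [PhiB, Fin.cons_succ]; exact posB hx i
    · intro hc
      obtain ⟨x, hx, h0, h⟩ := surjB hy (c 0) (b := fun j => c j.succ) hc
      refine ⟨x, hx, ?_⟩
      ext i
      refine Fin.cases ?_ (fun j => ?_) i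
      · rw [hrel0, h0]
      · have h1 := hrel x j
        rw [← h j] at h1
        exact mul_right_cancel₀ (W_ne hy.injective j) h1
  have hinj : Set.InjOn (PhiB y) S := by
    intro x hx x' hx' h
    refine injB (a := PhiB y x 0) (b := fun j => PhiB y x j.succ) hx hx' (hrel0 x) ?_ (hrel x) ?_
    · rw [h]; exact hrel0 x'
    · rw [h]; exact hrel x'
  have hcv := lintegral_image_eq_lintegral_abs_det_fderiv_mul volume hSm
    (fun x _ => (PhiB_deriv y x).hasFDerivWithinAt) hinj
    (fun c => ENNReal.ofReal (Real.exp (-(c 0) ^ 2)) * ∏ i : Fin n, gam 2 γ (c i.succ))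
  have hTm : MeasurableSet {c : Fin (n + 1) → ℝ | ∀ j : Fin n, 0 < c j.succ} := by
    rw [Set.ofPred_forall]
    exact MeasurableSet.iInter fun i => measurableSet_lt (by fun_prop) (by fun_prop)
  rw [himg, ← lintegral_indicator hTm, ← lintegral_indicator hSm] at hcv
  refine Eq.trans ?_ (hcv.trans ?_)
  · refine lintegral_congr fun c => ?_
    by_cases hc : c ∈ {c : Fin (n + 1) → ℝ | ∀ j : Fin n, 0 < c j.succ}
    · rw [Set.indicator_of_mem hc]
    · rw [Set.indicator_of_notMem hc]
      simp only [Set.mem_ofPred_eq, not_forall] at hc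
      obtain ⟨i, hi⟩ := hc
      rw [Finset.prod_eq_zero (mem_univ i) (Set.indicator_of_notMem hi _), mul_zero]
  · refine lintegral_congr fun x => ?_
    by_cases hz : x ∈ S
    · rw [hB, Set.indicator_of_mem hz, Set.indicator_of_mem hz]
      have hI : Il x y := hz
      have hpos : ∀ j : Fin n, 0 < PhiB y x j.succ := fun j => by
        rw [PhiB, Fin.cons_succ]; exact posB hI j
      have e1 : ∀ j : Fin n, gam 2 γ (PhiB y x j.succ) =
          ENNReal.ofReal (PhiB y x j.succ ^ (γ - 1) * Real.exp (-(2 * PhiB y x j.succ))) := fun j =>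
        Set.indicator_of_mem (hpos j) _
      simp only [e1]
      rw [det_toLin, ← ENNReal.ofReal_prod_of_nonneg (fun i _ => by
        have := hpos i; positivity), ← ENNReal.ofReal_mul (by positivity),
        ← ENNReal.ofReal_mul (by positivity)]
      congr 1
      have hVy := V_pos hy.injective
      have hPr := hI.Pr_pos
      have hsum := (keyB_sum (keyB hy.injective x _ _ (hrel0 x) (hrel x))).2
      rw [Finset.prod_mul_distrib, Real.finsetProd_rpow _ _ (fun i _ => (hpos i).le),
        ← Real.exp_sum, PhiB_prod hI, DB_det hI]
      have e4 : Real.exp (-(PhiB y x 0) ^ 2) * Real.exp (∑ j : Fin n, -(2 * PhiB y x j.succ)) =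
          Real.exp (∑ j, y j ^ 2) * Real.exp (-∑ i, x i ^ 2) := by
        rw [← Real.exp_add, ← Real.exp_add, hsum]
        congr 1
        rw [Finset.sum_neg_distrib, ← Finset.mul_sum]
        ring
      have e5 := rpowB (V x) γ hPr hVy
      calc _ = (V x / V y * (Pr x y / V y ^ 2) ^ (γ - 1)) * (Real.exp (-(PhiB y x 0) ^ 2) *
              Real.exp (∑ j : Fin n, -(2 * PhiB y x j.succ))) := by ring
        _ = _ := by rw [e4, e5]; ring
    · rw [Set.indicator_of_notMem hz, hB, Set.indicator_of_notMem hz]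

/-- the Mehta density -/
noncomputable def F (γ : ℝ) {n : ℕ} (x : Fin n → ℝ) : ℝ≥0∞ :=
  ENNReal.ofReal (V x ^ (2 * γ) * Real.exp (-∑ i, x i ^ 2))

lemma F_meas (γ : ℝ) {n : ℕ} : Measurable (F γ : (Fin n → ℝ) → ℝ≥0∞) := by
  have := V_meas (n := n)
  unfold F; fun_prop

lemma SM_meas {n : ℕ} : MeasurableSet {x : Fin n → ℝ | StrictMono x} := by
  unfold StrictMono
  simp only [Set.ofPred_forall]
  refine MeasurableSet.iInter fun i => MeasurableSet.iInter fun j => MeasurableSet.iInter fun _ => ?_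
  exact measurableSet_lt (by fun_prop) (by fun_prop)

lemma V_perm {n : ℕ} (x : Fin n → ℝ) (σ : Equiv.Perm (Fin n)) : V (x ∘ σ) = V x := by
  rw [V_eq_det, V_eq_det]
  have : Matrix.vandermonde (x ∘ σ) = (Matrix.vandermonde x).submatrix σ id := by
    ext; simp [Matrix.vandermonde_apply]
  rw [this, Matrix.det_permute, abs_mul]
  rcases Int.units_eq_one_or (Equiv.Perm.sign σ) with h | h <;> rw [h] <;> simp

lemma F_perm (γ : ℝ) {n : ℕ} (x : Fin n → ℝ) (σ : Equiv.Perm (Fin n)) : F γ (x ∘ σ) = F γ x := by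
  rw [F, F, V_perm]
  congr 4
  exact Equiv.sum_comp σ (fun i => x i ^ 2)

lemma symm_lint {γ : ℝ} (hγ : 0 < γ) (n : ℕ) :
    ∫⁻ x : Fin n → ℝ, F γ x = (n.factorial : ℝ≥0∞) *
      ∫⁻ x : Fin n → ℝ, {x | StrictMono x}.indicator (F γ) x := by
  classical
  have h1 : ∀ x : Fin n → ℝ, F γ x = ∑ σ : Equiv.Perm (Fin n),
      {x | StrictMono x}.indicator (F γ) (x ∘ σ) := by
    intro x
    by_cases hx : Function.Injective x
    · rw [Finset.sum_eq_single (Tuple.sort x)]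
      · rw [Set.indicator_of_mem, F_perm]
        exact (Tuple.monotone_sort x).strictMono_of_injective (hx.comp (Equiv.injective _))
      · intro σ _ hσ
        apply Set.indicator_of_notMem
        intro h
        have h : StrictMono (x ∘ σ) := h
        apply hσ
        have := Tuple.unique_monotone h.monotone (Tuple.monotone_sort x)
        ext i
        exact congrArg _ (hx (congrFun this i))
      · simp
    · rw [F, V_eq_zero hx, Real.zero_rpow (by positivity)]
      symm
      simp only [zero_mul, ENNReal.ofReal_zero]
      refine Finset.sum_eq_zero fun σ _ => Set.indicator_of_notMem ?_ _
      intro h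
      have h : StrictMono (x ∘ σ) := h
      exact hx ((Equiv.injective_comp σ x).1 h.injective)
  have hm : Measurable ({x : Fin n → ℝ | StrictMono x}.indicator (F γ)) :=
    (F_meas γ).indicator SM_meas
  simp_rw [h1]
  rw [lintegral_finsetSum]
  · have : ∀ σ : Equiv.Perm (Fin n),
        ∫⁻ x : Fin n → ℝ, {x | StrictMono x}.indicator (F γ) (x ∘ σ) =
        ∫⁻ x : Fin n → ℝ, {x | StrictMono x}.indicator (F γ) x := by
      intro σ
      have h := volume_measurePreserving_piCongrLeft (fun _ : Fin n => ℝ) σ.symm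
      rw [← h.lintegral_comp_emb (MeasurableEquiv.measurableEmbedding _)
        ({x | StrictMono x}.indicator (F γ))]
      refine lintegral_congr fun x => ?_
      congr 1
      ext i
      simp [MeasurableEquiv.piCongrLeft, Equiv.piCongrLeft, Equiv.piCongrLeft']
    simp_rw [this]
    simp [Fintype.card_perm]
  · intro σ _
    exact hm.comp (by fun_prop)

/-- the two-level density -/
noncomputable def K (γ : ℝ) {n : ℕ} (x : Fin (n + 1) → ℝ) (y : Fin n → ℝ) : ℝ≥0∞ :=
  {p : (Fin (n + 1) → ℝ) × (Fin n → ℝ) | Il p.1 p.2}.indicator (fun p =>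
    ENNReal.ofReal (V p.1 * V p.2 * Pr p.1 p.2 ^ (γ - 1) * Real.exp (-∑ i, p.1 i ^ 2))) (x, y)

lemma K_meas (γ : ℝ) {n : ℕ} :
    Measurable (Function.uncurry (K γ : (Fin (n + 1) → ℝ) → (Fin n → ℝ) → ℝ≥0∞)) := by
  refine Measurable.indicator ?_ Il_meas
  have h1 := V_meas (n := n)
  have h2 := V_meas (n := n + 1)
  have h3 := Pr_meas (n := n) (m := n + 1)
  fun_prop

lemma rpow_id {v : ℝ} (γ : ℝ) (hv : 0 < v) : v ^ (2 * γ) * v ^ (1 - 2 * γ) = v := by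
  rw [← Real.rpow_add hv]; simp

lemma K_eq_A (γ : ℝ) {n : ℕ} (x : Fin (n + 1) → ℝ) (y : Fin n → ℝ) :
    K γ x y = F γ x * hA γ x y := by
  by_cases h : Il x y
  · rw [K, hA, Set.indicator_of_mem (show (x, y) ∈ _ from h),
      Set.indicator_of_mem (show y ∈ {y | Il x y} from h), F, ← ENNReal.ofReal_mul (by
        have := V_nonneg x; positivity)]
    congr 1
    have := rpow_id γ (V_pos h.strictMono_left.injective)
    simp only
    conv_lhs => rw [← this]
    ring
  · rw [K, hA, Set.indicator_of_notMem (show (x, y) ∉ _ from h),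
      Set.indicator_of_notMem (show y ∉ {y | Il x y} from h), mul_zero]

lemma K_eq_B (γ : ℝ) {n : ℕ} (x : Fin (n + 1) → ℝ) (y : Fin n → ℝ) :
    K γ x y = F γ y * hB γ y x := by
  by_cases h : Il x y
  · rw [K, hB, Set.indicator_of_mem (show (x, y) ∈ _ from h),
      Set.indicator_of_mem (show x ∈ {x | Il x y} from h), F, ← ENNReal.ofReal_mul (by
        have := V_nonneg y; positivity)]
    congr 1
    have := rpow_id γ (V_pos h.strictMono_right.injective)
    have e : Real.exp (-∑ i, y i ^ 2) * Real.exp (∑ i, y i ^ 2) = 1 := by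
      rw [← Real.exp_add]; simp
    simp only
    calc _ = V x * (V y ^ (2 * γ) * V y ^ (1 - 2 * γ)) * Pr x y ^ (γ - 1) *
          Real.exp (-∑ i, x i ^ 2) * (Real.exp (-∑ i, y i ^ 2) * Real.exp (∑ i, y i ^ 2)) := by
            rw [this, e, mul_one]
      _ = _ := by ring
  · rw [K, hB, Set.indicator_of_notMem (show (x, y) ∉ _ from h),
      Set.indicator_of_notMem (show x ∉ {x | Il x y} from h), mul_zero]

lemma lintA {γ : ℝ} (hγ : 0 < γ) {n : ℕ} (x : Fin (n + 1) → ℝ) :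
    ENNReal.ofReal (Real.Gamma ((n + 1) * γ)) * ∫⁻ y, K γ x y =
      {x | StrictMono x}.indicator (F γ) x * ENNReal.ofReal (Real.Gamma γ) ^ (n + 1) := by
  by_cases hx : StrictMono x
  · rw [Set.indicator_of_mem (show x ∈ {x | StrictMono x} from hx), mainA hγ hx]
    simp_rw [K_eq_A]
    rw [lintegral_const_mul _ (hA_meas γ x)]
    ring
  · rw [Set.indicator_of_notMem (show x ∉ {x | StrictMono x} from hx)]
    have : ∀ y, K γ x y = 0 := fun y =>
      Set.indicator_of_notMem (show (x, y) ∉ _ from fun h => hx (Il.strictMono_left h)) _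
    simp [this]

lemma lintB {γ : ℝ} (hγ : 0 < γ) {n : ℕ} (y : Fin n → ℝ) :
    ∫⁻ x, K γ x y = {y | StrictMono y}.indicator (F γ) y *
      (ENNReal.ofReal √π * ENNReal.ofReal ((1 / 2) ^ γ * Real.Gamma γ) ^ n) := by
  by_cases hy : StrictMono y
  · rw [Set.indicator_of_mem (show y ∈ {y | StrictMono y} from hy), mainB hγ hy]
    simp_rw [K_eq_B]
    rw [lintegral_const_mul' _ _ (by simp [F])]
  · rw [Set.indicator_of_notMem (show y ∉ {y | StrictMono y} from hy)]
    have : ∀ x, K γ x y = 0 := fun x =>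
      Set.indicator_of_notMem (show (x, y) ∉ _ from fun h => hy (Il.strictMono_right h)) _
    simp [this]

lemma recursion {γ : ℝ} (hγ : 0 < γ) (n : ℕ) :
    (∫⁻ x : Fin (n + 1) → ℝ, {x | StrictMono x}.indicator (F γ) x) *
      ENNReal.ofReal (Real.Gamma γ) ^ (n + 1) =
    ENNReal.ofReal (Real.Gamma ((n + 1) * γ)) *
     ((∫⁻ y : Fin n → ℝ, {y | StrictMono y}.indicator (F γ) y) *
      (ENNReal.ofReal √π * ENNReal.ofReal ((1 / 2) ^ γ * Real.Gamma γ) ^ n)) := by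
  rw [← lintegral_mul_const _ ((F_meas γ).indicator SM_meas),
    ← lintegral_mul_const _ ((F_meas γ).indicator SM_meas)]
  simp_rw [← lintA hγ, ← lintB hγ]
  rw [lintegral_const_mul' _ _ (by simp), lintegral_lintegral_swap (K_meas γ).aemeasurable]

/-- the value on the chamber -/
noncomputable def val (γ : ℝ) : ℕ → ℝ
  | 0 => 1
  | n + 1 => √π * (1 / 2) ^ (γ * n) * Real.Gamma (1 + (n + 1) * γ) / Real.Gamma (1 + γ) * val γ n

lemma val_pos {γ : ℝ} (hγ : 0 < γ) (n : ℕ) : 0 < val γ n := by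
  induction n with
  | zero => simp [val]
  | succ n ih =>
    rw [val]
    have h1 : 0 < Real.Gamma (1 + (n + 1) * γ) := Real.Gamma_pos_of_pos (by positivity)
    have h2 : 0 < Real.Gamma (1 + γ) := Real.Gamma_pos_of_pos (by positivity)
    have := Real.pi_pos
    positivity

lemma lint_F {γ : ℝ} (hγ : 0 < γ) (n : ℕ) : ∫⁻ x : Fin n → ℝ, F γ x = ENNReal.ofReal (val γ n) := by
  induction n with
  | zero => simp [val, F, V, volume_pi]
  | succ n ih =>
    have hr := recursion hγ n
    rw [symm_lint hγ] at ih ⊢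
    set A := ∫⁻ x : Fin (n + 1) → ℝ, {x | StrictMono x}.indicator (F γ) x
    set B := ∫⁻ x : Fin n → ℝ, {x | StrictMono x}.indicator (F γ) x
    have hG := Real.Gamma_pos_of_pos hγ
    have hG2 : 0 < Real.Gamma ((n + 1) * γ) := Real.Gamma_pos_of_pos (by positivity)
    have hne : ENNReal.ofReal (Real.Gamma γ) ^ (n + 1) ≠ 0 := by positivity
    have hnt : ENNReal.ofReal (Real.Gamma γ) ^ (n + 1) ≠ ⊤ := by simp
    rw [← ENNReal.mul_left_inj hne hnt]
    have hfac : ((n + 1).factorial : ℝ≥0∞) = ENNReal.ofReal ((n : ℝ) + 1) * (n.factorial : ℝ≥0∞) := by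
      rw [Nat.factorial_succ]; push_cast
      rw [ENNReal.ofReal_add (by positivity) zero_le_one]; simp
    have e1 : Real.Gamma (1 + (n + 1) * γ) = ((n + 1) * γ) * Real.Gamma ((n + 1) * γ) := by
      rw [add_comm, Real.Gamma_add_one (by positivity)]
    have e2 : Real.Gamma (1 + γ) = γ * Real.Gamma γ := by
      rw [add_comm, Real.Gamma_add_one (by positivity)]
    have hv := val_pos hγ n
    calc ((n + 1).factorial : ℝ≥0∞) * A * ENNReal.ofReal (Real.Gamma γ) ^ (n + 1)
        = ENNReal.ofReal ((n : ℝ) + 1) * ENNReal.ofReal (Real.Gamma ((n + 1) * γ)) *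
          ((n.factorial : ℝ≥0∞) * B) *
          (ENNReal.ofReal √π * ENNReal.ofReal ((1 / 2) ^ γ * Real.Gamma γ) ^ n) := by
          rw [mul_assoc, hr, hfac]; ring
      _ = _ := by
        rw [ih, ← ENNReal.ofReal_pow (by positivity), ← ENNReal.ofReal_pow (by positivity),
          ← ENNReal.ofReal_mul (by positivity), ← ENNReal.ofReal_mul (by positivity),
          ← ENNReal.ofReal_mul (by positivity), ← ENNReal.ofReal_mul (by positivity),
          ← ENNReal.ofReal_mul (val_pos hγ (n + 1)).le]
        congr 1
        rw [val, e1, e2, mul_pow, ← Real.rpow_natCast ((1 / 2) ^ γ), ← Real.rpow_mul (by norm_num)]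
        field_simp
        ring

lemma val_eq {γ : ℝ} (n : ℕ) (hγ : 0 < γ) : val γ n = π ^ ((n : ℝ) / 2) /
    2 ^ ((n * (n - 1) : ℝ) * γ / 2) *
      ∏ j ∈ Icc 2 n, Real.Gamma (1 + j * γ) / Real.Gamma (1 + γ) := by
  have hG : Real.Gamma (1 + γ) ≠ 0 := (Real.Gamma_pos_of_pos (by positivity)).ne'
  have h : ∀ n : ℕ, ∏ j ∈ Icc 2 n, Real.Gamma (1 + j * γ) / Real.Gamma (1 + γ) =
      ∏ j ∈ range n, Real.Gamma (1 + (j + 1) * γ) / Real.Gamma (1 + γ) := by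
    intro n
    induction n with
    | zero => simp
    | succ n ih =>
      rw [Finset.prod_range_succ, ← ih]
      rcases Nat.eq_zero_or_pos n with h | h
      · subst h; simp [hG]
      · rw [Finset.prod_Icc_succ_top (by omega)]; push_cast; rfl
  rw [h]
  induction n with
  | zero => simp [val]
  | succ n ih =>
    rw [val, ih, Finset.prod_range_succ, Real.sqrt_eq_rpow]
    have a1 : π ^ (((n + 1 : ℕ) : ℝ) / 2) = π ^ ((n : ℝ) / 2) * π ^ (1 / 2 : ℝ) := by
      rw [← Real.rpow_add Real.pi_pos]; push_cast; congr 1; ring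
    have a2 : (2 : ℝ) ^ ((((n + 1 : ℕ) : ℝ) * (((n + 1 : ℕ) : ℝ) - 1)) * γ / 2) =
        2 ^ ((n * (n - 1) : ℝ) * γ / 2) * 2 ^ (γ * n) := by
      rw [← Real.rpow_add two_pos]; push_cast; congr 1; ring
    rw [a1, a2, Real.div_rpow zero_le_one zero_le_two, Real.one_rpow]
    field_simp

end Mehta

/-- Mehta-type Gaussian integral with Vandermonde interaction. -/
theorem mehta_gaussian_integral (n : ℕ) (β : ℝ) (hn : 1 ≤ n) (hβ : 0 < β) :
    ∫ u : Fin n → ℝ,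
        (∏ i, Real.exp (-(u i) ^ 2)) *
          ∏ p ∈ Finset.univ.filter (fun p : Fin n × Fin n => p.1 < p.2),
            |u p.1 - u p.2| ^ ((4 : ℝ) / β)
      = Real.pi ^ ((n : ℝ) / 2) / 2 ^ ((n * (n - 1) : ℝ) / β) *
          ∏ j ∈ Finset.Icc 2 n, Real.Gamma (1 + 2 * j / β) / Real.Gamma (1 + 2 / β) := by
  have hγ : 0 < 2 / β := by positivity
  have hF := Mehta.lint_F hγ n
  have hpt : ∀ u : Fin n → ℝ, (∏ i, Real.exp (-(u i) ^ 2)) *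
      ∏ p ∈ Finset.univ.filter (fun p : Fin n × Fin n => p.1 < p.2),
        |u p.1 - u p.2| ^ ((4 : ℝ) / β) =
      Mehta.V u ^ (2 * (2 / β)) * Real.exp (-∑ i, u i ^ 2) := by
    intro u
    rw [Real.finsetProd_rpow _ _ (fun _ _ => abs_nonneg _), ← Real.exp_sum,
      Finset.sum_neg_distrib, mul_comm, show 2 * (2 / β) = 4 / β by ring]
    congr 2
    rw [Mehta.V, Finset.prod_sigma']
    refine Finset.prod_bij' (fun p _ => ⟨p.1, p.2⟩) (fun p _ => (p.1, p.2)) ?_ ?_ ?_ ?_ ?_ <;>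
      simp [abs_sub_comm]
  simp_rw [hpt]
  have hm : Measurable fun u : Fin n → ℝ =>
      Mehta.V u ^ (2 * (2 / β)) * Real.exp (-∑ i, u i ^ 2) := by
    have := Mehta.V_meas (n := n)
    fun_prop
  rw [integral_eq_lintegral_of_nonneg_ae _ hm.aestronglyMeasurable]
  · have hF' : ∫⁻ u : Fin n → ℝ, ENNReal.ofReal
        (Mehta.V u ^ (2 * (2 / β)) * Real.exp (-∑ i, u i ^ 2)) =
        ENNReal.ofReal (Mehta.val (2 / β) n) := hF
    rw [hF', ENNReal.toReal_ofReal (Mehta.val_pos hγ n).le, Mehta.val_eq n hγ]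
    congr 2
    · congr 1; ring
    · ext j; congr 2; ring
  · filter_upwards with u
    have := Mehta.V_nonneg u
    positivity
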